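/- The degree 10 plane curve C'₁ : f'₁ = 0 is a minimal plus-one generated (MPOG) curve with exponents (5,5,6) and total Tjurina number τ(C'₁) = 59, and the curves C'₀ : f'₀ = 0 and C'_{b'} : f'_{b'} = 0 are nearly free curves with exponents (5,5) and τ(C'₀) = τ(C'_{b'}) = 60. -/

import Mathlib

open MvPolynomial

noncomputable section

/-- `S = ℂ[x,y,z]`, with `x = X 0`, `y = X 1`, `z = X 2`. -/
abbrev S3 := MvPolynomial (Fin 3) ℂ

/-- The graded `S`-module `D_0(f)` of Jacobian syzygies of `f`. -/
def jacSyz (f : S3) : Submodule S3 (Fin 3 → S3) where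
  carrier := {v | v 0 * pderiv 0 f + v 1 * pderiv 1 f + v 2 * pderiv 2 f = 0}
  add_mem' := by
    intro a b ha hb
    simp only [Set.mem_setOf_eq, Pi.add_apply] at *
    linear_combination ha + hb
  zero_mem' := by simp
  smul_mem' := by
    intro c v hv
    simp only [Set.mem_setOf_eq, Pi.smul_apply, smul_eq_mul] at *
    linear_combination c * hv

/-- `v` is a minimal system of `m` homogeneous generators of `D_0(f)`, the generator
`v j` being a syzygy of degree `dd j`, and `dd` nondecreasing: this says that
`C : f = 0` is an `m`-syzygy curve with exponents `dd`. -/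
structure IsMinGenSyz (f : S3) (m : ℕ) (dd : Fin m → ℕ) (v : Fin m → (Fin 3 → S3)) : Prop where
  mem : ∀ j, v j ∈ jacSyz f
  hom : ∀ j i, ((v j) i).IsHomogeneous (dd j)
  ne_zero : ∀ j, v j ≠ 0
  span_eq : Submodule.span S3 (Set.range v) = jacSyz f
  minimal : ∀ j, v j ∉ Submodule.span S3 (v '' {j' | j' ≠ j})
  mono : Monotone dd

/-- `C : f = 0` is free with exponents `(d1, d2)`. -/
def IsFreeWith (f : S3) (d1 d2 : ℕ) : Prop := ∃ v, IsMinGenSyz f 2 ![d1, d2] v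

/-- `C : f = 0` is a free curve (a 2-syzygy curve). -/
def IsFreeCurve (f : S3) : Prop := ∃ d1 d2, IsFreeWith f d1 d2

/-- `C : f = 0` of degree `d` is nearly free with exponents `(d1, d2)`:
a 3-syzygy curve with exponents `(d1, d2, d2)` and `d1 + d2 = d`. -/
def IsNearlyFreeWith (f : S3) (d d1 d2 : ℕ) : Prop :=
  d1 + d2 = d ∧ ∃ v, IsMinGenSyz f 3 ![d1, d2, d2] v

/-- `C : f = 0` of degree `d` is a nearly free curve. -/
def IsNearlyFree (f : S3) (d : ℕ) : Prop := ∃ d1 d2, IsNearlyFreeWith f d d1 d2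

/-- `C : f = 0` of degree `d` is plus-one generated with exponents `(d1, d2, d3)`:
a 3-syzygy curve with `d1 + d2 = d`. -/
def IsPOGWith (f : S3) (d d1 d2 d3 : ℕ) : Prop :=
  d1 + d2 = d ∧ ∃ v, IsMinGenSyz f 3 ![d1, d2, d3] v

/-- `C : f = 0` of degree `d` is a plus-one generated curve. -/
def IsPOG (f : S3) (d : ℕ) : Prop := ∃ d1 d2 d3, IsPOGWith f d d1 d2 d3

/-- `C : f = 0` of degree `d` is minimal plus-one generated (MPOG),
with exponents `(d1, d2, d2 + 1)`. -/
def IsMPOGWith (f : S3) (d d1 d2 : ℕ) : Prop := IsPOGWith f d d1 d2 (d2 + 1)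

/-- `C : f = 0` of degree `d` is an MPOG-curve. -/
def IsMPOG (f : S3) (d : ℕ) : Prop := ∃ d1 d2, IsMPOGWith f d d1 d2

/-- `r = mdr(f)`: the minimal degree of a nonzero (homogeneous) Jacobian relation for `f`. -/
def IsMDR (f : S3) (r : ℕ) : Prop :=
  (∃ v ∈ jacSyz f, v ≠ 0 ∧ ∀ i, (v i).IsHomogeneous r) ∧
  ∀ m, m < r → ∀ v ∈ jacSyz f, (∀ i, (v i).IsHomogeneous m) → v = 0

/-- The Jacobian ideal `J_f` of `f`. -/
def jacobianIdeal (f : S3) : Ideal S3 := Ideal.span {pderiv 0 f, pderiv 1 f, pderiv 2 f}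

/-- The dimension of the degree `k` graded piece of the Milnor algebra `M(f) = S/J_f`. -/
def milnorDim (f : S3) (k : ℕ) : ℕ :=
  Module.finrank ℂ
    (↥(homogeneousSubmodule (Fin 3) ℂ k) ⧸
      (Submodule.comap (homogeneousSubmodule (Fin 3) ℂ k).subtype
        (Submodule.restrictScalars ℂ (jacobianIdeal f))))

/-- `τ` is the total Tjurina number of the reduced curve `C : f = 0`, i.e. the degree of the
Jacobian ideal `J_f`: for all large `k` one has `dim M(f)_k = τ`. -/
def IsTjurina (f : S3) (τ : ℕ) : Prop := ∀ᶠ k in Filter.atTop, milnorDim f k = τ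

/-- `C : f = 0` is a maximal Tjurina curve of type `(d, r)`. -/
def IsMaxTjurina (f : S3) (d r : ℕ) : Prop :=
  IsMDR f r ∧ d ≤ 2 * r ∧
  ∃ τ : ℕ, IsTjurina f τ ∧
    (τ : ℤ) = ((d : ℤ) - 1) ^ 2 - r * ((d : ℤ) - r - 1) - (Nat.choose (2 * r + 2 - d) 2 : ℤ)

/-- `f` is a product of `d` linear forms all vanishing at a common point, i.e.
`C : f = 0` is the union of `d` lines passing through one point. -/
def IsUnionOfConcurrentLines (f : S3) (d : ℕ) : Prop :=
  ∃ (c : ℂ) (L : Fin d → Fin 3 → ℂ) (v : Fin 3 → ℂ), v ≠ 0 ∧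
    f = C c * ∏ j, (∑ i, C (L j i) * X i) ∧ ∀ j, (∑ i, L j i * v i) = 0

/-- The ideal `I_θ` generated by the 2×2 minors of the matrix with rows `(x,y,z)` and
`(a,b,c)`, defining the eigenscheme `Γ_θ` of the derivation `θ = a ∂_x + b ∂_y + c ∂_z`. -/
def eigenIdeal (a b c : S3) : Ideal S3 :=
  Ideal.span {X 1 * c - X 2 * b, X 2 * a - X 0 * c, X 0 * b - X 1 * a}

/-- The projective plane `ℙ²(ℂ)`. -/
abbrev Pt := Projectivization ℂ (Fin 3 → ℂ)

/-- The eigenscheme `Γ_θ` of `θ = a ∂_x + b ∂_y + c ∂_z` is 0-dimensional: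
its set of points in `ℙ²` is finite. -/
def EigenSchemeFinite (a b c : S3) : Prop :=
  {p : Pt | eval p.rep (X 1 * c - X 2 * b) = 0 ∧ eval p.rep (X 2 * a - X 0 * c) = 0 ∧
      eval p.rep (X 0 * b - X 1 * a) = 0}.Finite

/-- The homogenization `f'₀` of the Briançon-type polynomial `g'`. -/
def f0' : S3 :=
  X 0 ^ 6 * X 1 ^ 4 + 4 * X 0 ^ 5 * X 1 ^ 3 * X 2 ^ 2 + 3 * X 0 ^ 4 * X 1 ^ 3 * X 2 ^ 3 +
    6 * X 0 ^ 4 * X 1 ^ 2 * X 2 ^ 4 + C (65 / 9 : ℂ) * X 0 ^ 3 * X 1 ^ 2 * X 2 ^ 5 +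
    4 * X 0 ^ 3 * X 1 * X 2 ^ 6 + 3 * X 0 ^ 2 * X 1 ^ 2 * X 2 ^ 6 +
    C (49 / 9 : ℂ) * X 0 ^ 2 * X 1 * X 2 ^ 7 + X 0 ^ 2 * X 2 ^ 8 +
    C (10 / 3 : ℂ) * X 0 * X 1 * X 2 ^ 8 + C (11 / 9 : ℂ) * X 0 * X 2 ^ 9 + X 1 * X 2 ^ 9 +
    C (1 / 3 : ℂ) * X 2 ^ 10

/-- `f'_{b'} = f'₀ + (64/81) z¹⁰`. -/
def fb' : S3 := f0' + C (64 / 81 : ℂ) * X 2 ^ 10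

/-- `f'₁ = f'₀ - z¹⁰`. -/
def f1' : S3 := f0' - X 2 ^ 10

/-- If `κ p ^ n` is a combination of `A` and `B` with `p` a prime not dividing `A`, then every
solution of `a B = b A` is a multiple of `(A, B)`. -/
lemma exists_eq_mul_of_mul_eq_mul {R : Type*} [CommRing R] [IsDomain R] {p A B α β κ a b : R}
    {n : ℕ} (hp : Prime p) (hA : ¬ p ∣ A) (hκ : IsUnit κ) (ht : κ * p ^ n = α * A + β * B)
    (hab : a * B = b * A) : ∃ c, a = c * A ∧ b = c * B := by
  have hA0 : A ≠ 0 := fun h => hA (h ▸ dvd_zero p)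
  have key : κ * p ^ n * a = (α * a + β * b) * A := by
    linear_combination a * ht + β * hab
  obtain ⟨d, hd⟩ : p ^ n ∣ α * a + β * b :=
    hp.pow_dvd_of_dvd_mul_right n hA ⟨κ * a, by linear_combination -key⟩
  obtain ⟨u, hu⟩ := hκ.exists_left_inv
  have hκa : κ * a = d * A := by
    refine mul_left_cancel₀ (pow_ne_zero n hp.ne_zero) ?_
    linear_combination key + A * hd
  have ha : a = u * d * A := by linear_combination u * hκa - a * hu
  refine ⟨u * d, ha, mul_right_cancel₀ hA0 ?_⟩
  linear_combination B * ha - hab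

/-- The substitution `y ↦ u x + w z`. -/
def substY (u w : ℂ) : S3 →ₐ[ℂ] S3 := aeval ![X 0, C u * X 0 + C w * X 2, X 2]

lemma dvd_sub_substY (u w : ℂ) (p : S3) : (X 1 - (C u * X 0 + C w * X 2)) ∣ p - substY u w p := by
  induction p using MvPolynomial.induction_on with
  | C a => simp [substY]
  | add p q hp hq =>
    rw [map_add, add_sub_add_comm]
    exact dvd_add hp hq
  | mul_X p i hp =>
    have hi : (X 1 - (C u * X 0 + C w * X 2) : S3) ∣ X i - substY u w (X i) := by
      fin_cases i <;> simp [substY]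
    rw [map_mul, show p * X i - substY u w p * substY u w (X i) =
      (p - substY u w p) * X i + substY u w p * (X i - substY u w (X i)) by ring]
    exact dvd_add (hp.mul_right _) (hi.mul_left _)

lemma substY_idem (u w : ℂ) (p : S3) : substY u w (substY u w p) = substY u w p := by
  have : (substY u w).comp (substY u w) = substY u w := by
    refine algHom_ext fun i => ?_
    fin_cases i <;> simp [substY, algHom_C]
  exact DFunLike.congr_fun this p

lemma eval_substY (u w s t : ℂ) (p : S3) :
    eval ![s, u * s + w * t, t] (substY u w p) = eval ![s, u * s + w * t, t] p := by
  induction p using MvPolynomial.induction_on with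
  | C a => simp [substY]
  | add p q hp hq => simp only [map_add, hp, hq]
  | mul_X p i hp =>
    rw [map_mul, map_mul, map_mul, hp]
    congr 1
    fin_cases i <;> simp [substY]

lemma exists_sum_eq_of_mem_span_image_ne {R M ι : Type*} [CommRing R] [AddCommGroup M]
    [Module R M] [Fintype ι] [DecidableEq ι] (v : ι → M) {j : ι} {x : M}
    (hx : x ∈ Submodule.span R (v '' {j' | j' ≠ j})) :
    ∃ c : ι → R, c j = 0 ∧ ∑ j', c j' • v j' = x := by
  induction hx using Submodule.span_induction with
  | mem x hx =>
    obtain ⟨j', hj', rfl⟩ := hx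
    exact ⟨Pi.single j' 1, Pi.single_eq_of_ne' hj' 1, by simp [Pi.single_apply]⟩
  | zero => exact ⟨0, rfl, by simp⟩
  | add x y _ _ hx hy =>
    obtain ⟨c, h1, rfl⟩ := hx
    obtain ⟨c', h1', rfl⟩ := hy
    exact ⟨c + c', by simp [h1, h1'], by simp [add_smul, Finset.sum_add_distrib]⟩
  | smul a x _ hx =>
    obtain ⟨c, h1, rfl⟩ := hx
    exact ⟨a • c, by simp [h1], by simp [Finset.smul_sum, mul_smul]⟩

/-- Explicit data proving that `D_0(f)` has generators `r₁, r₂, r₃` and the single relation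
`A r₁ + B r₂ = h r₃`, where `h = b (y - u x - w z)` is a linear form and `F` is proportional to
the gradient of `f`. -/
structure SyzygyCertificate (f : S3) (F r₁ r₂ r₃ : Fin 3 → S3) (A B h : S3) (b u w : ℂ) :
    Prop where
  gradient : ∃ c : ℂ, c ≠ 0 ∧ ∀ i, F i = C c * pderiv i f
  coprime : ∃ (c : ℂ) (n : ℕ) (α β : S3), c ≠ 0 ∧ C c * X 2 ^ n = α * F 0 + β * F 1
  eval_gradient : eval ![1, 1, 0] (F 0) ≠ 0
  syzygy_left : r₁ 0 * F 0 + r₁ 1 * F 1 + r₁ 2 * F 2 = 0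
  syzygy_right : r₂ 0 * F 0 + r₂ 1 * F 1 + r₂ 2 * F 2 = 0
  cross_zero : r₁ 1 * r₂ 2 - r₁ 2 * r₂ 1 = h * F 0
  cross_one : r₁ 2 * r₂ 0 - r₁ 0 * r₂ 2 = h * F 1
  cross_two : r₁ 0 * r₂ 1 - r₁ 1 * r₂ 0 = h * F 2
  relation : ∀ i, h * r₃ i = A * r₁ i + B * r₂ i
  scale_ne_zero : b ≠ 0
  linear : h = C b * (X 1 - (C u * X 0 + C w * X 2))
  coprime_relation : ∃ (c : ℂ) (n : ℕ) (α β δ : S3),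
    c ≠ 0 ∧ C c * X 2 ^ n = α * A + β * B + δ * h
  eval_relation : eval ![1, u, 0] A ≠ 0
  eval_generator : ∃ i s t, eval ![s, u * s + w * t, t] (r₁ i) ≠ 0

namespace SyzygyCertificate

variable {f : S3} {F r₁ r₂ r₃ : Fin 3 → S3} {A B h : S3} {b u w : ℂ}

lemma isUnit_C {c : ℂ} (hc : c ≠ 0) : IsUnit (C c : S3) := hc.isUnit.map C

lemma mem_jacSyz_iff (H : SyzygyCertificate f F r₁ r₂ r₃ A B h b u w) (s : Fin 3 → S3) :
    s ∈ jacSyz f ↔ s 0 * F 0 + s 1 * F 1 + s 2 * F 2 = 0 := by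
  obtain ⟨c, hc, hF⟩ := H.gradient
  have hC : (C c : S3) ≠ 0 := (isUnit_C hc).ne_zero
  change s 0 * pderiv 0 f + s 1 * pderiv 1 f + s 2 * pderiv 2 f = 0 ↔ _
  rw [hF, hF, hF, ← mul_eq_zero_iff_left hC]
  constructor <;> intro e <;> linear_combination e

lemma gradient_ne_zero (H : SyzygyCertificate f F r₁ r₂ r₃ A B h b u w) : F 0 ≠ 0 :=
  fun e => H.eval_gradient (by rw [e, map_zero])

lemma linear_ne_zero (H : SyzygyCertificate f F r₁ r₂ r₃ A B h b u w) : h ≠ 0 := by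
  intro e
  have := congrArg (eval ![0, 1, 0]) (H.linear.symm.trans e)
  simp [H.scale_ne_zero] at this

lemma substY_linear (H : SyzygyCertificate f F r₁ r₂ r₃ A B h b u w) : substY u w h = 0 := by
  rw [H.linear]
  simp [substY, algHom_C]

lemma dvd_of_substY_eq (H : SyzygyCertificate f F r₁ r₂ r₃ A B h b u w) {p q : S3}
    (e : substY u w p = substY u w q) : h ∣ p - q := by
  rw [H.linear, (isUnit_C H.scale_ne_zero).mul_left_dvd]
  simpa [e] using dvd_sub_substY u w (p - q)

lemma eval_substY_point (p : S3) : eval ![1, u, 0] (substY u w p) = eval ![1, u, 0] p := by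
  simpa using eval_substY u w 1 0 p

lemma substY_relation_ne_zero (H : SyzygyCertificate f F r₁ r₂ r₃ A B h b u w) :
    substY u w A ≠ 0 := by
  intro e
  apply H.eval_relation
  rw [← eval_substY_point (w := w), e, map_zero]

/-- A vector orthogonal to two syzygies is a multiple of the gradient. -/
lemma exists_cross_eq (H : SyzygyCertificate f F r₁ r₂ r₃ A B h b u w) {s t : Fin 3 → S3}
    (hs : s 0 * F 0 + s 1 * F 1 + s 2 * F 2 = 0) (ht : t 0 * F 0 + t 1 * F 1 + t 2 * F 2 = 0) :
    ∃ a, s 1 * t 2 - s 2 * t 1 = a * F 0 ∧ s 2 * t 0 - s 0 * t 2 = a * F 1 ∧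
      s 0 * t 1 - s 1 * t 0 = a * F 2 := by
  obtain ⟨c, n, α, β, hc, hz⟩ := H.coprime
  have hX : ¬ (X 2 : S3) ∣ F 0 := fun ⟨q, hq⟩ => H.eval_gradient (by simp [hq])
  obtain ⟨a, h0, h1⟩ := exists_eq_mul_of_mul_eq_mul (p := (X 2 : S3)) X_prime hX (isUnit_C hc) hz
    (a := s 1 * t 2 - s 2 * t 1) (b := s 2 * t 0 - s 0 * t 2)
    (by linear_combination t 2 * hs - s 2 * ht)
  refine ⟨a, h0, h1, mul_right_cancel₀ H.gradient_ne_zero ?_⟩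
  linear_combination t 1 * hs - s 1 * ht + F 2 * h0

lemma exists_combination (H : SyzygyCertificate f F r₁ r₂ r₃ A B h b u w) {s : Fin 3 → S3}
    (hs : s 0 * F 0 + s 1 * F 1 + s 2 * F 2 = 0) :
    ∃ a a' c : S3, ∀ i, s i = a * r₁ i + a' * r₂ i + c * r₃ i := by
  obtain ⟨p, p0, p1, p2⟩ := H.exists_cross_eq hs H.syzygy_right
  obtain ⟨q, q0, q1, q2⟩ := H.exists_cross_eq H.syzygy_left hs
  have hF := H.gradient_ne_zero
  have det : s 0 * (r₁ 1 * r₂ 2 - r₁ 2 * r₂ 1) + s 1 * (r₁ 2 * r₂ 0 - r₁ 0 * r₂ 2) +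
      s 2 * (r₁ 0 * r₂ 1 - r₁ 1 * r₂ 0) = 0 := by
    linear_combination s 0 * H.cross_zero + s 1 * H.cross_one + s 2 * H.cross_two + h * hs
  have hcomb : ∀ i, h * s i = p * r₁ i + q * r₂ i := by
    intro i
    refine mul_right_cancel₀ hF ?_
    fin_cases i
    · simp only [Fin.zero_eta]
      linear_combination det - s 0 * H.cross_zero + r₁ 0 * p0 + r₂ 0 * q0
    · simp only [Fin.mk_one]
      linear_combination r₁ 1 * p0 + r₂ 1 * q0 - s 1 * H.cross_zero
    · simp only [Fin.reduceFinMk]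
      linear_combination r₁ 2 * p0 + r₂ 2 * q0 - s 2 * H.cross_zero
  have hh := H.substY_linear
  have hsub : ∀ i, substY u w p * substY u w (r₁ i) + substY u w q * substY u w (r₂ i) = 0 := by
    intro i
    have := congrArg (substY u w) (hcomb i)
    rw [map_mul, hh, zero_mul, map_add, map_mul, map_mul] at this
    exact this.symm
  have hrel : ∀ i, substY u w A * substY u w (r₁ i) + substY u w B * substY u w (r₂ i) = 0 := by
    intro i
    have := congrArg (substY u w) (H.relation i)
    rw [map_mul, hh, zero_mul, map_add, map_mul, map_mul] at this
    exact this.symm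
  obtain ⟨i, x, z, hi⟩ := H.eval_generator
  have hi' : substY u w (r₁ i) ≠ 0 := by
    intro e
    apply hi
    rw [← eval_substY, e, map_zero]
  have hpq : substY u w p * substY u w B = substY u w q * substY u w A := by
    refine mul_right_cancel₀ hi' ?_
    linear_combination substY u w B * hsub i - substY u w q * hrel i
  obtain ⟨c, n, α, β, δ, hc, hz⟩ := H.coprime_relation
  have hz' : C c * X 2 ^ n = substY u w α * substY u w A + substY u w β * substY u w B := by
    have := congrArg (substY u w) hz
    simp only [map_add, map_mul, hh, mul_zero, add_zero, map_pow, algHom_C] at this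
    simpa [substY] using this
  have hX : ¬ (X 2 : S3) ∣ substY u w A := by
    rintro ⟨v, hv⟩
    apply H.eval_relation
    rw [← eval_substY_point (w := w), hv]
    simp
  obtain ⟨g, g1, g2⟩ := exists_eq_mul_of_mul_eq_mul X_prime hX (isUnit_C hc) hz' hpq
  obtain ⟨a, ha⟩ : h ∣ p - g * A := H.dvd_of_substY_eq (by
    rw [← substY_idem, g1, map_mul, substY_idem, map_mul])
  obtain ⟨a', ha'⟩ : h ∣ q - g * B := H.dvd_of_substY_eq (by
    rw [← substY_idem, g2, map_mul, substY_idem, map_mul])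
  refine ⟨a, a', g, fun i => mul_left_cancel₀ H.linear_ne_zero ?_⟩
  linear_combination hcomb i + r₁ i * ha + r₂ i * ha' - g * H.relation i

lemma exists_multiple (H : SyzygyCertificate f F r₁ r₂ r₃ A B h b u w) {a a' c : S3}
    (hs : ∀ i, a * r₁ i + a' * r₂ i + c * r₃ i = 0) :
    ∃ g, a = g * A ∧ a' = g * B ∧ c = g * -h := by
  have hh := H.linear_ne_zero
  have hhF : h * F 0 ≠ 0 := mul_ne_zero hh H.gradient_ne_zero
  have e : ∀ i, (h * a + c * A) * r₁ i + (h * a' + c * B) * r₂ i = 0 := by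
    intro i
    linear_combination h * hs i - c * H.relation i
  have e1 : h * a + c * A = 0 := by
    refine (mul_eq_zero.mp ?_).resolve_right hhF
    rw [← H.cross_zero]
    linear_combination r₂ 2 * e 1 - r₂ 1 * e 2
  have e2 : h * a' + c * B = 0 := by
    refine (mul_eq_zero.mp ?_).resolve_right hhF
    rw [← H.cross_zero]
    linear_combination r₁ 1 * e 2 - r₁ 2 * e 1
  have hc : substY u w c = 0 := by
    have := congrArg (substY u w) e1
    rw [map_add, map_mul, map_mul, H.substY_linear, zero_mul, zero_add, map_zero] at this
    exact (mul_eq_zero.mp this).resolve_right H.substY_relation_ne_zero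
  obtain ⟨g, hg⟩ : h ∣ c - 0 := H.dvd_of_substY_eq (by rw [hc, map_zero])
  rw [sub_zero] at hg
  refine ⟨-g, mul_left_cancel₀ hh ?_, mul_left_cancel₀ hh ?_, by rw [hg]; ring⟩
  · linear_combination e1 - A * hg
  · linear_combination e2 - B * hg

lemma mem_jacSyz (H : SyzygyCertificate f F r₁ r₂ r₃ A B h b u w) (j : Fin 3) :
    ![r₁, r₂, r₃] j ∈ jacSyz f := by
  rw [H.mem_jacSyz_iff]
  fin_cases j
  · exact H.syzygy_left
  · exact H.syzygy_right
  · refine (mul_eq_zero.mp ?_).resolve_left H.linear_ne_zero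
    change h * (r₃ 0 * F 0 + r₃ 1 * F 1 + r₃ 2 * F 2) = 0
    linear_combination F 0 * H.relation 0 + F 1 * H.relation 1 + F 2 * H.relation 2 +
      A * H.syzygy_left + B * H.syzygy_right

lemma span_eq (H : SyzygyCertificate f F r₁ r₂ r₃ A B h b u w) :
    Submodule.span S3 (Set.range ![r₁, r₂, r₃]) = jacSyz f := by
  apply le_antisymm
  · rw [Submodule.span_le]
    rintro _ ⟨j, rfl⟩
    exact H.mem_jacSyz j
  · intro s hs
    obtain ⟨a, a', c, e⟩ := H.exists_combination ((H.mem_jacSyz_iff s).mp hs)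
    rw [Submodule.mem_span_range_iff_exists_fun]
    refine ⟨![a, a', c], ?_⟩
    ext1 i
    simp [Fin.sum_univ_three, e i]

lemma eq_smul_of_sum_eq_zero (H : SyzygyCertificate f F r₁ r₂ r₃ A B h b u w) (c : Fin 3 → S3)
    (hc : ∀ i, ∑ j, c j * ![r₁, r₂, r₃] j i = 0) : ∃ g, ∀ j, c j = g * ![A, B, -h] j := by
  obtain ⟨g, h0, h1, h2⟩ := H.exists_multiple (a := c 0) (a' := c 1) (c := c 2) (fun i => by
    simpa [Fin.sum_univ_three] using hc i)
  refine ⟨g, fun j => ?_⟩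
  fin_cases j
  · exact h0
  · exact h1
  · exact h2

lemma notMem_span (H : SyzygyCertificate f F r₁ r₂ r₃ A B h b u w)
    (hP : ∀ j, constantCoeff (![A, B, -h] j) = 0) (j : Fin 3) :
    ![r₁, r₂, r₃] j ∉ Submodule.span S3 (![r₁, r₂, r₃] '' {j' | j' ≠ j}) := by
  intro hmem
  obtain ⟨c, hcj, hc⟩ := exists_sum_eq_of_mem_span_image_ne ![r₁, r₂, r₃] hmem
  obtain ⟨g, hg⟩ := H.eq_smul_of_sum_eq_zero (c - Pi.single j 1) (fun i => by
    have hci := congrFun hc i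
    simp only [Finset.sum_apply, Pi.smul_apply, smul_eq_mul] at hci
    simp only [Pi.sub_apply, sub_mul, Finset.sum_sub_distrib, hci, Pi.single_apply, ite_mul,
      one_mul, zero_mul, Finset.sum_ite_eq', Finset.mem_univ, if_true, sub_self])
  have hgj := congrArg constantCoeff (hg j)
  rw [map_mul, hP] at hgj
  simp [hcj] at hgj

lemma isMinGenSyz (H : SyzygyCertificate f F r₁ r₂ r₃ A B h b u w)
    (hP : ∀ j, constantCoeff (![A, B, -h] j) = 0) (dd : Fin 3 → ℕ) (hdd : Monotone dd)
    (hom : ∀ j i, (![r₁, r₂, r₃] j i).IsHomogeneous (dd j)) :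
    IsMinGenSyz f 3 dd ![r₁, r₂, r₃] where
  mem := H.mem_jacSyz
  hom := hom
  ne_zero j e := H.notMem_span hP j (e ▸ Submodule.zero_mem _)
  span_eq := H.span_eq
  minimal := H.notMem_span hP
  mono := hdd

end SyzygyCertificate


lemma finrank_homogeneousSubmodule (n : ℕ) :
    Module.finrank ℂ (homogeneousSubmodule (Fin 3) ℂ n) = (n + 2).choose 2 := by
  have hset : {d : Fin 3 →₀ ℕ | d.degree = n} =
      ((Finset.univ : Finset (Fin 3)).finsuppAntidiag n : Set (Fin 3 →₀ ℕ)) := by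
    ext d
    simp [Finset.mem_finsuppAntidiag, Finsupp.degree_eq_sum]
  rw [homogeneousSubmodule_eq_finsupp_supported, hset,
    (AddMonoidAlgebra.supportedEquivFinsupp _).finrank_eq, Module.finrank_finsupp_self]
  simp only [SetLike.coe_sort_coe, Fintype.card_coe, Finset.card_finsuppAntidiag_nat_eq_choose,
    Finset.card_univ, Fintype.card_fin]
  rw [show 3 + n - 1 = n + 2 by omega, Nat.choose_symm_add]

instance finite_homogeneousSubmodule (n : ℕ) :
    Module.Finite ℂ (homogeneousSubmodule (Fin 3) ℂ n) :=
  Module.Finite.of_fg (homogeneousSubmodule_fg (Fin 3) ℂ n)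

lemma homogeneousComponent_mul_of_isHomogeneous {d n k : ℕ} {p q : S3} (hq : q.IsHomogeneous d)
    (hk : n + d = k) : homogeneousComponent k (p * q) = homogeneousComponent n p * q := by
  let _ : GradedAlgebra (homogeneousSubmodule (Fin 3) ℂ) := gradedAlgebra
  have key := DirectSum.coe_decompose_mul_of_right_mem_of_le
    (homogeneousSubmodule (Fin 3) ℂ) (a := p) (b := q) (n := k) hq (by omega)
  rw [show k - d = n by omega] at key
  have e (φ : S3) (i : ℕ) : (DirectSum.decompose (homogeneousSubmodule (Fin 3) ℂ) φ i : S3) =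
      homogeneousComponent i φ := decomposition.decompose'_apply φ i
  rwa [e, e] at key

/-- The map `a ↦ ∑ i, a i * p i` on graded pieces. -/
def gradedRow {ι : Type*} [Fintype ι] (p : ι → S3) (d n : ι → ℕ) (k : ℕ)
    (hp : ∀ i, (p i).IsHomogeneous (d i)) (hk : ∀ i, n i + d i = k) :
    ((i : ι) → homogeneousSubmodule (Fin 3) ℂ (n i)) →ₗ[ℂ] homogeneousSubmodule (Fin 3) ℂ k where
  toFun a := ⟨∑ i, (a i : S3) * p i,
    Submodule.sum_mem _ fun i _ => by
      have := ((mem_homogeneousSubmodule _ _).mp (a i).2).mul (hp i)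
      rwa [hk] at this⟩
  map_add' a b := by
    ext1
    simp [add_mul, Finset.sum_add_distrib]
  map_smul' c a := by
    ext1
    simp [Finset.smul_sum]

@[simp] lemma coe_gradedRow {ι : Type*} [Fintype ι] (p : ι → S3) (d n : ι → ℕ) (k : ℕ)
    (hp : ∀ i, (p i).IsHomogeneous (d i)) (hk : ∀ i, n i + d i = k) (a) :
    (gradedRow p d n k hp hk a : S3) = ∑ i, (a i : S3) * p i := rfl

/-- Replace the coefficients of a combination of homogeneous polynomials by homogeneous ones. -/
lemma sum_homogeneousComponent_mul {ι : Type*} [Fintype ι] {p : ι → S3} {d n : ι → ℕ} {k : ℕ}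
    (hp : ∀ i, (p i).IsHomogeneous (d i)) (hk : ∀ i, n i + d i = k) {a : ι → S3} {g : S3}
    (hg : g.IsHomogeneous k) (h : ∑ i, a i * p i = g) :
    ∑ i, homogeneousComponent (n i) (a i) * p i = g := by
  rw [← homogeneousComponent_eq_self hg, ← h, map_sum]
  exact Finset.sum_congr rfl fun i _ =>
    (homogeneousComponent_mul_of_isHomogeneous (hp i) (hk i)).symm

lemma mem_jacobianIdeal_iff (f g : S3) :
    g ∈ jacobianIdeal f ↔ ∃ a : Fin 3 → S3, ∑ i, a i * pderiv i f = g := by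
  rw [jacobianIdeal, Submodule.mem_span_triple]
  constructor
  · rintro ⟨a, b, c, rfl⟩
    exact ⟨![a, b, c], by simp [Fin.sum_univ_three]⟩
  · rintro ⟨a, rfl⟩
    exact ⟨a 0, a 1, a 2, by simp [Fin.sum_univ_three]⟩

/-- The Hilbert function of the Milnor algebra, from a resolution of length one of `D_0(f)`. -/
lemma milnorDim_add {f : S3} {d ρ m : ℕ} {v : Fin 3 → Fin 3 → S3} {P : Fin 3 → S3}
    {dd e : Fin 3 → ℕ} (hf : f.IsHomogeneous (d + 1))
    (hv : ∀ j i, (v j i).IsHomogeneous (dd j)) (hP : ∀ j, (P j).IsHomogeneous (e j))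
    (hde : ∀ j, dd j + e j = ρ) (hm : ρ ≤ m)
    (hspan : Submodule.span S3 (Set.range v) = jacSyz f)
    (hrel : ∀ i, ∑ j, P j * v j i = 0) (hP0 : ∃ j, P j ≠ 0)
    (hker : ∀ c : Fin 3 → S3, (∀ i, ∑ j, c j * v j i = 0) → ∃ g, ∀ j, c j = g * P j) :
    milnorDim f (m + d) + 3 * (m + 2).choose 2 + (m - ρ + 2).choose 2 =
      (m + d + 2).choose 2 + ∑ j, (m - dd j + 2).choose 2 := by
  have hpd : ∀ i, (pderiv i f).IsHomogeneous d := fun i => hf.pderiv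
  have hddm : ∀ j, m - dd j + dd j = m := fun j => by have := hde j; omega
  have hem : ∀ j, m - ρ + e j = m - dd j := fun j => by have := hde j; omega
  set Φ := gradedRow (fun i => pderiv i f) (fun _ => d) (fun _ => m) (m + d) hpd (fun _ => rfl)
    with hΦ
  set Ψ := LinearMap.pi fun i : Fin 3 =>
    gradedRow (fun j => v j i) dd (fun j => m - dd j) m (fun j => hv j i) hddm with hΨ
  set Θ := LinearMap.pi fun j : Fin 3 =>
    gradedRow (fun _ : Unit => P j) (fun _ => e j) (fun _ => m - ρ) (m - dd j) (fun _ => hP j)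
      (fun _ => hem j) with hΘ
  have hrange : Submodule.comap (homogeneousSubmodule (Fin 3) ℂ (m + d)).subtype
      (Submodule.restrictScalars ℂ (jacobianIdeal f)) = LinearMap.range Φ := by
    ext g
    simp only [Submodule.mem_comap, Submodule.subtype_apply, Submodule.restrictScalars_mem,
      mem_jacobianIdeal_iff, LinearMap.mem_range]
    constructor
    · rintro ⟨a, ha⟩
      refine ⟨fun i => ⟨homogeneousComponent m (a i), homogeneousComponent_mem _ _⟩, ?_⟩
      ext1
      exact sum_homogeneousComponent_mul (d := fun _ => d) (n := fun _ => m) hpd (fun _ => rfl)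
        g.2 ha
    · rintro ⟨a, rfl⟩
      exact ⟨fun i => a i, rfl⟩
  have hkerΦ : LinearMap.ker Φ = LinearMap.range Ψ := by
    ext s
    have hs : s ∈ LinearMap.ker Φ ↔ (fun i => (s i : S3)) ∈ jacSyz f := by
      rw [LinearMap.mem_ker, ← Submodule.coe_eq_zero, coe_gradedRow, Fin.sum_univ_three]
      rfl
    rw [hs, ← hspan, Submodule.mem_span_range_iff_exists_fun, LinearMap.mem_range]
    constructor
    · rintro ⟨c, hc⟩
      refine ⟨fun j => ⟨homogeneousComponent (m - dd j) (c j), homogeneousComponent_mem _ _⟩, ?_⟩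
      ext1 i
      ext1
      refine sum_homogeneousComponent_mul (fun j => hv j i) hddm (s i).2 ?_
      simpa [Finset.sum_apply] using congrFun hc i
    · rintro ⟨c, rfl⟩
      refine ⟨fun j => c j, ?_⟩
      ext1 i
      simp [hΨ, Finset.sum_apply]
  have hkerΨ : LinearMap.ker Ψ = LinearMap.range Θ := by
    ext c
    have hc : c ∈ LinearMap.ker Ψ ↔ ∀ i, ∑ j, (c j : S3) * v j i = 0 := by
      rw [LinearMap.mem_ker, funext_iff]
      refine forall_congr' fun i => ?_
      rw [Pi.zero_apply, ← Submodule.coe_eq_zero]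
      rfl
    rw [hc, LinearMap.mem_range]
    constructor
    · intro h
      obtain ⟨g, hg⟩ := hker _ h
      refine ⟨fun _ => ⟨homogeneousComponent (m - ρ) g, homogeneousComponent_mem _ _⟩, ?_⟩
      ext1 j
      ext1
      refine sum_homogeneousComponent_mul (ι := Unit) (a := fun _ => g) (fun _ => hP j)
        (fun _ => hem j) (c j).2 ?_
      simpa using (hg j).symm
    · rintro ⟨g, rfl⟩ i
      have := congrArg ((g () : S3) * ·) (hrel i)
      simpa [hΘ, Finset.mul_sum, mul_assoc] using this
  have hkerΘ : LinearMap.ker Θ = ⊥ := by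
    rw [LinearMap.ker_eq_bot']
    intro g hg
    obtain ⟨j, hj⟩ := hP0
    have h0 : (g () : S3) * P j = 0 := by
      have := congrArg Subtype.val (congrFun hg j)
      simpa [hΘ] using this
    ext1 t
    ext1
    exact (mul_eq_zero.mp h0).resolve_right hj
  have rΦ := LinearMap.finrank_range_add_finrank_ker Φ
  have rΨ := LinearMap.finrank_range_add_finrank_ker Ψ
  have rΘ := LinearMap.finrank_range_add_finrank_ker Θ
  have rQ := Submodule.finrank_quotient_add_finrank (LinearMap.range Φ)
  rw [hkerΦ] at rΦ
  rw [hkerΨ] at rΨ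
  rw [hkerΘ, finrank_bot] at rΘ
  simp only [Module.finrank_pi_fintype, finrank_homogeneousSubmodule, Finset.sum_const,
    Finset.card_univ, Fintype.card_fin, Fintype.card_unit, smul_eq_mul, one_mul, add_zero]
    at rΦ rΨ rΘ rQ
  have hdim : milnorDim f (m + d) = Module.finrank ℂ
      (homogeneousSubmodule (Fin 3) ℂ (m + d) ⧸ LinearMap.range Φ) := by
    rw [milnorDim, hrange]
  omega

lemma two_mul_choose_two (n : ℕ) : 2 * (n + 2).choose 2 = (n + 2) * (n + 1) := by
  rw [Nat.choose_two_right, Nat.mul_div_cancel' (Nat.even_mul_pred_self _).two_dvd]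
  rfl


/-- The gradient of `81 f'₀`, with `t z⁹` added to its last component. -/
def pencilGradient {R : Type*} [CommRing R] (x y z t : R) : Fin 3 → R := ![
    486 * x ^ 5 * y ^ 4 + 1620 * x ^ 4 * y ^ 3 * z ^ 2 + 972 * x ^ 3 * y ^ 3 * z ^ 3 +
      1944 * x ^ 3 * y ^ 2 * z ^ 4 + 1755 * x ^ 2 * y ^ 2 * z ^ 5 + 972 * x ^ 2 * y * z ^ 6 +
      486 * x * y ^ 2 * z ^ 6 + 882 * x * y * z ^ 7 + 162 * x * z ^ 8 + 270 * y * z ^ 8 +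
      99 * z ^ 9,
    324 * x ^ 6 * y ^ 3 + 972 * x ^ 5 * y ^ 2 * z ^ 2 + 729 * x ^ 4 * y ^ 2 * z ^ 3 +
      972 * x ^ 4 * y * z ^ 4 + 1170 * x ^ 3 * y * z ^ 5 + 324 * x ^ 3 * z ^ 6 +
      486 * x ^ 2 * y * z ^ 6 + 441 * x ^ 2 * z ^ 7 + 270 * x * z ^ 8 + 81 * z ^ 9,
    648 * x ^ 5 * y ^ 3 * z + 729 * x ^ 4 * y ^ 3 * z ^ 2 + 1944 * x ^ 4 * y ^ 2 * z ^ 3 +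
      2925 * x ^ 3 * y ^ 2 * z ^ 4 + 1944 * x ^ 3 * y * z ^ 5 + 1458 * x ^ 2 * y ^ 2 * z ^ 5 +
      3087 * x ^ 2 * y * z ^ 6 + 648 * x ^ 2 * z ^ 7 + 2160 * x * y * z ^ 7 + 891 * x * z ^ 8 +
      729 * y * z ^ 8 + 270 * z ^ 9 + t * z ^ 9]

/-- A syzygy of `f0'` of degree 5. -/
def firstSyzygyZero {R : Type*} [CommRing R] (x y z : R) : Fin 3 → R := ![
    -21060 * x ^ 3 * y ^ 2 + 33280 * x ^ 3 * y * z - 7236 * x ^ 2 * y * z ^ 2 +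
      33280 * x ^ 2 * z ^ 3 - 34425 * x * y * z ^ 3 + 38784 * x * z ^ 4 + 23040 * z ^ 5,
    31590 * x ^ 2 * y ^ 3 - 49920 * x ^ 2 * y ^ 2 * z + 31104 * x * y ^ 2 * z ^ 2 -
      66560 * x * y * z ^ 3 + 54675 * y ^ 2 * z ^ 3 - 25446 * y * z ^ 4 - 16640 * z ^ 5,
    -4860 * x ^ 2 * y ^ 2 * z - 8316 * x * y * z ^ 3 - 6075 * y * z ^ 4 - 3456 * z ^ 5]

/-- A syzygy of `f0'` of degree 5. -/
def secondSyzygyZero {R : Type*} [CommRing R] (x y z : R) : Fin 3 → R := ![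
    -4259840 * x ^ 4 * y - 492804 * x ^ 3 * y ^ 2 - 1769472 * x ^ 3 * y * z -
      4259840 * x ^ 3 * z ^ 2 + 1891836 * x ^ 2 * y * z ^ 2 - 4964352 * x ^ 2 * z ^ 3 -
      805545 * x * y * z ^ 3 - 2949120 * x * z ^ 4,
    6389760 * x ^ 3 * y ^ 2 + 739206 * x ^ 2 * y ^ 3 + 1410048 * x ^ 2 * y ^ 2 * z +
      8519680 * x ^ 2 * y * z ^ 2 - 3763584 * x * y ^ 2 * z ^ 2 + 4604928 * x * y * z ^ 3 +
      2129920 * x * z ^ 4 + 1279395 * y ^ 2 * z ^ 3 + 473850 * y * z ^ 4,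
    622080 * x ^ 3 * y ^ 2 - 113724 * x ^ 2 * y ^ 2 * z + 1064448 * x ^ 2 * y * z ^ 2 +
      663876 * x * y * z ^ 3 + 442368 * x * z ^ 4 - 142155 * y * z ^ 4]

/-- A syzygy of `f0'` of degree 5. -/
def thirdSyzygyZero {R : Type*} [CommRing R] (x y z : R) : Fin 3 → R := ![
    2560 * x ^ 4 * y + 468 * x ^ 3 * y * z + 2560 * x ^ 3 * z ^ 2 + 2388 * x ^ 2 * z ^ 3 +
      765 * x * z ^ 4,
    -3840 * x ^ 3 * y ^ 2 - 702 * x ^ 2 * y ^ 2 * z - 5120 * x ^ 2 * y * z ^ 2 -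
      3072 * x * y * z ^ 3 - 1280 * x * z ^ 4 - 1215 * y * z ^ 4 - 450 * z ^ 5,
    108 * x ^ 2 * y * z ^ 2 + 108 * x * z ^ 4 + 135 * z ^ 5]

/-- A syzygy of `fb'` of degree 5. -/
def firstSyzygyB {R : Type*} [CommRing R] (x y z : R) : Fin 3 → R := ![
    -2340 * x ^ 3 * y ^ 2 - 456192 * x ^ 3 * y * z + 46044 * x ^ 2 * y * z ^ 2 -
      456192 * x ^ 2 * z ^ 3 - 3825 * x * y * z ^ 3 - 224640 * x * z ^ 4 + 10240 * z ^ 5,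
    3510 * x ^ 2 * y ^ 3 + 684288 * x ^ 2 * y ^ 2 * z - 66816 * x * y ^ 2 * z ^ 2 +
      995328 * x * y * z ^ 3 + 6075 * y ^ 2 * z ^ 3 + 232650 * y * z ^ 4 + 311040 * z ^ 5,
    -540 * x ^ 2 * y ^ 2 * z - 41472 * x ^ 2 * y * z ^ 2 + 1764 * x * y * z ^ 3 -
      41472 * x * z ^ 4 - 675 * y * z ^ 4 - 28800 * z ^ 5]

/-- A syzygy of `fb'` of degree 5. -/
def secondSyzygyB {R : Type*} [CommRing R] (x y z : R) : Fin 3 → R := ![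
    642318336 * x ^ 4 * y - 91260 * x ^ 3 * y ^ 2 - 68124672 * x ^ 3 * y * z +
      642318336 * x ^ 3 * z ^ 2 + 3322500 * x ^ 2 * y * z ^ 2 + 316293120 * x ^ 2 * z ^ 3 -
      149175 * x * y * z ^ 3 - 14417920 * x * z ^ 4,
    -963477504 * x ^ 3 * y ^ 2 + 136890 * x ^ 2 * y ^ 3 + 101265408 * x ^ 2 * y ^ 2 * z -
      1401421824 * x ^ 2 * y * z ^ 2 - 5932800 * x * y ^ 2 * z ^ 2 - 325324800 * x * y * z ^ 3 -
      437944320 * x * z ^ 4 + 236925 * y ^ 2 * z ^ 3 + 295750 * y * z ^ 4,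
    460800 * x ^ 3 * y ^ 2 + 58392576 * x ^ 3 * y * z - 21060 * x ^ 2 * y ^ 2 * z -
      2783232 * x ^ 2 * y * z ^ 2 + 58392576 * x ^ 2 * z ^ 3 + 704700 * x * y * z ^ 3 +
      40550400 * x * z ^ 4 - 26325 * y * z ^ 4]

/-- A syzygy of `fb'` of degree 5. -/
def thirdSyzygyB {R : Type*} [CommRing R] (x y z : R) : Fin 3 → R := ![
    50688 * x ^ 4 * y + 1404 * x ^ 3 * y * z + 50688 * x ^ 3 * z ^ 2 + 31740 * x ^ 2 * z ^ 3 +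
      2295 * x * z ^ 4,
    -76032 * x ^ 3 * y ^ 2 - 2106 * x ^ 2 * y ^ 2 * z - 110592 * x ^ 2 * y * z ^ 2 -
      40320 * x * y * z ^ 3 - 34560 * x * z ^ 4 - 3645 * y * z ^ 4 - 4550 * z ^ 5,
    4608 * x ^ 3 * y * z + 324 * x ^ 2 * y * z ^ 2 + 4608 * x ^ 2 * z ^ 3 + 3780 * x * z ^ 4 +
      405 * z ^ 5]

/-- A syzygy of `f1'` of degree 5. -/
def firstSyzygyOne {R : Type*} [CommRing R] (x y z : R) : Fin 3 → R := ![
    108210600 * x ^ 4 * y + 42120 * x ^ 3 * y ^ 2 + 25302316 * x ^ 3 * y * z +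
      108210600 * x ^ 3 * z ^ 2 + 1081728 * x ^ 2 * y * z ^ 2 + 52354966 * x ^ 2 * z ^ 3 +
      68850 * x * y * z ^ 3 + 12547335 * x * z ^ 4 + 128880 * z ^ 5,
    -162315900 * x ^ 3 * y ^ 2 - 63180 * x ^ 2 * y ^ 3 - 37953474 * x ^ 2 * y ^ 2 * z -
      216421200 * x ^ 2 * y * z ^ 2 - 1663092 * x * y ^ 2 * z ^ 2 - 54634544 * x * y * z ^ 3 -
      54105300 * x * z ^ 4 - 109350 * y ^ 2 * z ^ 3 - 14562885 * y * z ^ 4 + 10371580 * z ^ 5,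
    9720 * x ^ 2 * y ^ 2 * z + 2014956 * x ^ 2 * y * z ^ 2 + 77868 * x * y * z ^ 3 +
      2014956 * x * z ^ 4 + 12150 * y * z ^ 4 + 1579365 * z ^ 5]

/-- A syzygy of `f1'` of degree 5. -/
def secondSyzygyOne {R : Type*} [CommRing R] (x y z : R) : Fin 3 → R := ![
    54908600 * x ^ 4 * y + 9628596 * x ^ 3 * y * z + 54908600 * x ^ 3 * z ^ 2 +
      161028 * x ^ 2 * y * z ^ 2 + 25675746 * x ^ 2 * z ^ 3 + 5566365 * x * z ^ 4 - 42120 * z ^ 5,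
    -82362900 * x ^ 3 * y ^ 2 - 14540094 * x ^ 2 * y ^ 2 * z - 109817200 * x ^ 2 * y * z ^ 2 -
      350892 * x * y ^ 2 * z ^ 2 - 24976464 * x * y * z ^ 3 - 27454300 * x * z ^ 4 -
      7364655 * y * z ^ 4 + 5610780 * z ^ 5,
    48600 * x ^ 3 * y ^ 2 + 1119636 * x ^ 2 * y * z ^ 2 + 67068 * x * y * z ^ 3 +
      1071036 * x * z ^ 4 + 833895 * z ^ 5]

/-- A syzygy of `f1'` of degree 6. -/
def thirdSyzygyOne {R : Type*} [CommRing R] (x y z : R) : Fin 3 → R := ![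
    -313200 * x ^ 5 * y - 46752 * x ^ 4 * y * z - 313200 * x ^ 4 * z ^ 2 +
      1404 * x ^ 3 * y * z ^ 2 - 125052 * x ^ 3 * z ^ 3 - 23940 * x ^ 2 * z ^ 4 +
      2295 * x * z ^ 5,
    469800 * x ^ 4 * y ^ 2 + 70128 * x ^ 3 * y ^ 2 * z + 626400 * x ^ 3 * y * z ^ 2 -
      2106 * x ^ 2 * y ^ 2 * z ^ 2 + 105168 * x ^ 2 * y * z ^ 3 + 156600 * x ^ 2 * z ^ 4 +
      30150 * x * y * z ^ 4 - 43260 * x * z ^ 5 - 3645 * y * z ^ 5 + 2700 * z ^ 6,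
    -5832 * x ^ 3 * y * z ^ 2 + 324 * x ^ 2 * y * z ^ 3 - 5832 * x ^ 2 * z ^ 4 -
      4050 * x * z ^ 5 + 405 * z ^ 6] 

lemma pencilGradient_eq (s : ℂ) (i : Fin 3) :
    pencilGradient (X 0) (X 1) (X 2) (C (810 * s)) i =
      C 81 * pderiv i (f0' + C s * X 2 ^ 10) := by
  have h65 : (C (65 / 9) : S3) = 65 * C (1 / 9) := by rw [← map_ofNat C, ← C_mul]; norm_num
  have h49 : (C (49 / 9) : S3) = 49 * C (1 / 9) := by rw [← map_ofNat C, ← C_mul]; norm_num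
  have h30 : (C (10 / 3) : S3) = 30 * C (1 / 9) := by rw [← map_ofNat C, ← C_mul]; norm_num
  have h11 : (C (11 / 9) : S3) = 11 * C (1 / 9) := by rw [← map_ofNat C, ← C_mul]; norm_num
  have h3 : (C (1 / 3) : S3) = 3 * C (1 / 9) := by rw [← map_ofNat C, ← C_mul]; norm_num
  have h9 : (C (1 / 9) : S3) * 9 = 1 := by rw [← map_ofNat C, ← C_mul]; norm_num
  have h81 : (C (81 : ℂ) : S3) = 81 := map_ofNat C 81
  have h810 : (C (810 * s) : S3) = 810 * C s := by rw [C_mul, map_ofNat]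
  rw [f0', h65, h49, h30, h11, h3, h81, h810]
  generalize hq : (C (1 / 9) : S3) = q at h9
  have hdq (i) : pderiv i q = 0 := by rw [← hq, pderiv_C]
  have hdn (n : ℕ) [n.AtLeastTwo] (i) : pderiv i (OfNat.ofNat n : S3) = 0 := by
    rw [← map_ofNat C, pderiv_C]
  fin_cases i <;>
    simp [pencilGradient, pderiv_X, hdq, hdn]
  · linear_combination (-9 * (195 * X 0 ^ 2 * X 1 ^ 2 * X 2 ^ 5 + 98 * X 0 * X 1 * X 2 ^ 7 +
      30 * X 1 * X 2 ^ 8 + 11 * X 2 ^ 9)) * h9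
  · linear_combination (-9 * (130 * X 0 ^ 3 * X 1 * X 2 ^ 5 + 49 * X 0 ^ 2 * X 2 ^ 7 +
      30 * X 0 * X 2 ^ 8)) * h9
  · linear_combination (-9 * (325 * X 0 ^ 3 * X 1 ^ 2 * X 2 ^ 4 + 343 * X 0 ^ 2 * X 1 * X 2 ^ 6 +
      240 * X 0 * X 1 * X 2 ^ 7 + 99 * X 0 * X 2 ^ 8 + 30 * X 2 ^ 9)) * h9

lemma pencilGradient_coprime {R : Type*} [CommRing R] (x y z t : R) :
    -243 * z ^ 17 = (144 * x ^ 6 * y ^ 2 + 288 * x ^ 5 * y * z ^ 2 + 216 * x ^ 4 * y * z ^ 3 +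
        144 * x ^ 4 * z ^ 4 + 88 * x ^ 3 * z ^ 5 + 45 * x ^ 2 * z ^ 6) *
          pencilGradient x y z t 0 +
      (-216 * x ^ 5 * y ^ 3 - 504 * x ^ 4 * y ^ 2 * z ^ 2 - 270 * x ^ 3 * y ^ 2 * z ^ 3 -
        360 * x ^ 3 * y * z ^ 4 - 132 * x ^ 2 * y * z ^ 5 - 72 * x ^ 2 * z ^ 6 + 10 * x * z ^ 7 -
        3 * z ^ 8) * pencilGradient x y z t 1 := by
  simp only [pencilGradient, Matrix.cons_val]
  ring

lemma eval_pencilGradient (t : S3) :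
    eval ![1, 1, 0] (pencilGradient (X 0) (X 1) (X 2) t 0) ≠ 0 := by
  simp [pencilGradient]

/-- Assemble a certificate for a member of the pencil `f'₀ + s z¹⁰`. -/
lemma SyzygyCertificate.of_pencil {s : ℂ} {t : S3} (ht : t = C (810 * s))
    {r₁ r₂ r₃ : Fin 3 → S3} {A B h : S3} {b u w : ℂ}
    (syzygy_left : ∑ i, r₁ i * pencilGradient (X 0) (X 1) (X 2) t i = 0)
    (syzygy_right : ∑ i, r₂ i * pencilGradient (X 0) (X 1) (X 2) t i = 0)
    (cross_zero : r₁ 1 * r₂ 2 - r₁ 2 * r₂ 1 = h * pencilGradient (X 0) (X 1) (X 2) t 0)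
    (cross_one : r₁ 2 * r₂ 0 - r₁ 0 * r₂ 2 = h * pencilGradient (X 0) (X 1) (X 2) t 1)
    (cross_two : r₁ 0 * r₂ 1 - r₁ 1 * r₂ 0 = h * pencilGradient (X 0) (X 1) (X 2) t 2)
    (relation : ∀ i, h * r₃ i = A * r₁ i + B * r₂ i)
    (scale_ne_zero : b ≠ 0)
    (linear : h = C b * (X 1 - (C u * X 0 + C w * X 2)))
    (coprime_relation : ∃ (c : ℂ) (n : ℕ) (α β δ : S3),
      c ≠ 0 ∧ C c * X 2 ^ n = α * A + β * B + δ * h)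
    (eval_relation : eval ![1, u, 0] A ≠ 0)
    (eval_generator : ∃ i s t, eval ![s, u * s + w * t, t] (r₁ i) ≠ 0) :
    SyzygyCertificate (f0' + C s * X 2 ^ 10) (pencilGradient (X 0) (X 1) (X 2) t)
      r₁ r₂ r₃ A B h b u w where
  gradient := ⟨81, by norm_num, fun i => by rw [ht, pencilGradient_eq]⟩
  coprime := ⟨-243, 17, _, _, by norm_num, by
    rw [C_neg, map_ofNat]
    exact pencilGradient_coprime _ _ _ t⟩
  eval_gradient := eval_pencilGradient t
  syzygy_left := by rw [← syzygy_left, Fin.sum_univ_three]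
  syzygy_right := by rw [← syzygy_right, Fin.sum_univ_three]
  cross_zero := cross_zero
  cross_one := cross_one
  cross_two := cross_two
  relation := relation
  scale_ne_zero := scale_ne_zero
  linear := linear
  coprime_relation := coprime_relation
  eval_relation := eval_relation
  eval_generator := eval_generator

lemma certificateZero : SyzygyCertificate (f0' + C 0 * X 2 ^ 10)
    (pencilGradient (X 0) (X 1) (X 2) 0) (firstSyzygyZero (X 0) (X 1) (X 2))
    (secondSyzygyZero (X 0) (X 1) (X 2)) (thirdSyzygyZero (X 0) (X 1) (X 2))
    (-4915200 * X 0) (-38400 * X 2) (40435200 * X 1) 40435200 0 0 := by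
  refine .of_pencil (by simp) ?_ ?_ ?_ ?_ ?_ (fun i => ?_) (by norm_num) ?_
    ⟨-38400, 1, 0, 1, 0, by norm_num, ?_⟩ (by norm_num) ⟨0, 1, 1, ?_⟩
  · simp only [Fin.sum_univ_three, firstSyzygyZero, pencilGradient, Matrix.cons_val]
    ring
  · simp only [Fin.sum_univ_three, secondSyzygyZero, pencilGradient, Matrix.cons_val]
    ring
  · simp only [firstSyzygyZero, secondSyzygyZero, pencilGradient, Matrix.cons_val]
    ring
  · simp only [firstSyzygyZero, secondSyzygyZero, pencilGradient, Matrix.cons_val]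
    ring
  · simp only [firstSyzygyZero, secondSyzygyZero, pencilGradient, Matrix.cons_val]
    ring
  · fin_cases i <;>
      simp only [firstSyzygyZero, secondSyzygyZero, thirdSyzygyZero, Fin.zero_eta, Fin.mk_one,
        Fin.reduceFinMk, Matrix.cons_val] <;>
      ring
  · rw [map_ofNat]
    simp
  · rw [C_neg, map_ofNat]
    ring
  · simp only [firstSyzygyZero, Matrix.cons_val, map_add, map_sub, map_mul, map_pow,
      map_neg, map_ofNat, eval_X]
    norm_num

lemma certificateB : SyzygyCertificate (f0' + C (64 / 81) * X 2 ^ 10)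
    (pencilGradient (X 0) (X 1) (X 2) 640) (firstSyzygyB (X 0) (X 1) (X 2))
    (secondSyzygyB (X 0) (X 1) (X 2)) (thirdSyzygyB (X 0) (X 1) (X 2))
    (-72089600 * X 0) (-51200 * X 2) (3328000 * X 1) 3328000 0 0 := by
  refine .of_pencil (by rw [show (810 * (64 / 81) : ℂ) = 640 by norm_num, map_ofNat])
    ?_ ?_ ?_ ?_ ?_ (fun i => ?_) (by norm_num) ?_
    ⟨-51200, 1, 0, 1, 0, by norm_num, ?_⟩ (by norm_num) ⟨0, 1, 1, ?_⟩
  · simp only [Fin.sum_univ_three, firstSyzygyB, pencilGradient, Matrix.cons_val]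
    ring
  · simp only [Fin.sum_univ_three, secondSyzygyB, pencilGradient, Matrix.cons_val]
    ring
  · simp only [firstSyzygyB, secondSyzygyB, pencilGradient, Matrix.cons_val]
    ring
  · simp only [firstSyzygyB, secondSyzygyB, pencilGradient, Matrix.cons_val]
    ring
  · simp only [firstSyzygyB, secondSyzygyB, pencilGradient, Matrix.cons_val]
    ring
  · fin_cases i <;>
      simp only [firstSyzygyB, secondSyzygyB, thirdSyzygyB, Fin.zero_eta, Fin.mk_one,
        Fin.reduceFinMk, Matrix.cons_val] <;>
      ring
  · rw [map_ofNat]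
    simp
  · rw [C_neg, map_ofNat]
    ring
  · simp only [firstSyzygyB, Matrix.cons_val, map_add, map_sub, map_mul, map_pow,
      map_neg, map_ofNat, eval_X]
    norm_num

lemma certificateOne : SyzygyCertificate (f0' + C (-1) * X 2 ^ 10)
    (pencilGradient (X 0) (X 1) (X 2) (-810)) (firstSyzygyOne (X 0) (X 1) (X 2))
    (secondSyzygyOne (X 0) (X 1) (X 2)) (thirdSyzygyOne (X 0) (X 1) (X 2))
    (46980000 * X 0 ^ 2 + 7012800 * X 0 * X 2 - 210600 * X 2 ^ 2)
    (-9396000 * X 0 * X 2 - 644400 * X 2 ^ 2)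
    (-16231590000 * X 0 - 6318000 * X 1 - 2148089400 * X 2)
    (-6318000) (-9017550 / 3510) (-1193383 / 3510) := by
  refine .of_pencil (by rw [mul_neg_one, C_neg, map_ofNat])
    ?_ ?_ ?_ ?_ ?_ (fun i => ?_) (by norm_num) ?_
    ⟨-136468800, 3, 290 * X 2, 1450 * X 0 + 117 * X 2, 0, by norm_num, ?_⟩ (by simp)
    ⟨0, 1, 1, ?_⟩
  · simp only [Fin.sum_univ_three, firstSyzygyOne, pencilGradient, Matrix.cons_val]
    ring
  · simp only [Fin.sum_univ_three, secondSyzygyOne, pencilGradient, Matrix.cons_val]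
    ring
  · simp only [firstSyzygyOne, secondSyzygyOne, pencilGradient, Matrix.cons_val]
    ring
  · simp only [firstSyzygyOne, secondSyzygyOne, pencilGradient, Matrix.cons_val]
    ring
  · simp only [firstSyzygyOne, secondSyzygyOne, pencilGradient, Matrix.cons_val]
    ring
  · fin_cases i <;>
      simp only [firstSyzygyOne, secondSyzygyOne, thirdSyzygyOne, Fin.zero_eta, Fin.mk_one,
        Fin.reduceFinMk, Matrix.cons_val] <;>
      ring
  · have hu : (C (-6318000) * C (-9017550 / 3510) : S3) = 16231590000 := by
      rw [← C_mul, ← map_ofNat C]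
      norm_num
    have hw : (C (-6318000) * C (-1193383 / 3510) : S3) = 2148089400 := by
      rw [← C_mul, ← map_ofNat C]
      norm_num
    have hb : (C (-6318000) : S3) = -6318000 := by rw [C_neg, map_ofNat]
    linear_combination -X 1 * hb + X 0 * hu + X 2 * hw
  · rw [C_neg, map_ofNat]
    ring
  · simp only [firstSyzygyOne, Matrix.cons_val, map_add, map_mul, map_pow, map_ofNat, eval_X]
    norm_num

lemma MvPolynomial.IsHomogeneous.of_eq {σ R : Type*} [CommSemiring R] {p : MvPolynomial σ R}
    {m n : ℕ} (h : p.IsHomogeneous m) (e : m = n) : p.IsHomogeneous n := e ▸ h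

lemma isHomogeneous_ofNat (n : ℕ) [n.AtLeastTwo] :
    (OfNat.ofNat n : S3).IsHomogeneous 0 := by
  rw [← map_ofNat C]
  exact isHomogeneous_C _ _

lemma isHomogeneous_neg_ofNat (n : ℕ) [n.AtLeastTwo] :
    (-OfNat.ofNat n : S3).IsHomogeneous 0 :=
  (isHomogeneous_ofNat n).neg

lemma isHomogeneous_sub {p q : S3} {n : ℕ} (hp : p.IsHomogeneous n) (hq : q.IsHomogeneous n) :
    (p - q).IsHomogeneous n :=
  hp.sub hq

lemma isHomogeneous_pencil (s : ℂ) : (f0' + C s * X 2 ^ 10).IsHomogeneous 10 := by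
  rw [f0']
  repeat' first
    | with_reducible apply IsHomogeneous.add
    | with_reducible apply isHomogeneous_sub
  all_goals
    with_reducible apply IsHomogeneous.of_eq
    · repeat' first
        | with_reducible exact isHomogeneous_X_pow _ _
        | with_reducible exact isHomogeneous_X _ _
        | with_reducible exact isHomogeneous_C _ _
        | with_reducible exact isHomogeneous_ofNat _
        | with_reducible exact isHomogeneous_neg_ofNat _
        | with_reducible apply IsHomogeneous.mul
    · norm_num

/-- Exponents and total Tjurina number of a curve of degree 10 with a certificate whose third
generator has degree `5 + k`. -/
lemma SyzygyCertificate.isMinGenSyz_and_isTjurina {f : S3}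
    {F r₁ r₂ r₃ : Fin 3 → S3} {A B h : S3} {b u w : ℂ}
    (H : SyzygyCertificate f F r₁ r₂ r₃ A B h b u w) {k τ : ℕ} (hf : f.IsHomogeneous 10)
    (hr₁ : ∀ i, (r₁ i).IsHomogeneous 5) (hr₂ : ∀ i, (r₂ i).IsHomogeneous 5)
    (hr₃ : ∀ i, (r₃ i).IsHomogeneous (5 + k)) (hA : A.IsHomogeneous (k + 1))
    (hB : B.IsHomogeneous (k + 1)) (hh : h.IsHomogeneous 1) (hk : k + τ = 60) :
    IsMinGenSyz f 3 ![5, 5, 5 + k] ![r₁, r₂, r₃] ∧ IsTjurina f τ := by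
  have hv : ∀ j i, (![r₁, r₂, r₃] j i).IsHomogeneous (![5, 5, 5 + k] j) := by
    intro j
    fin_cases j
    exacts [hr₁, hr₂, hr₃]
  have hP : ∀ j, (![A, B, -h] j).IsHomogeneous (![k + 1, k + 1, 1] j) := by
    intro j
    fin_cases j
    exacts [hA, hB, hh.neg]
  refine ⟨H.isMinGenSyz (fun j => ?_) _ ?_ hv, ?_⟩
  · rw [constantCoeff_eq]
    refine (hP j).coeff_eq_zero ?_
    fin_cases j <;> simp
  · intro i j hij
    fin_cases i <;> fin_cases j <;> simp at hij ⊢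
  · refine Filter.eventually_atTop.mpr ⟨k + 6 + 9, fun n hn => ?_⟩
    obtain ⟨t, rfl⟩ := Nat.exists_eq_add_of_le hn
    have key := milnorDim_add (ρ := k + 6) (m := k + 6 + t) (d := 9) hf hv hP
      (fun j => by fin_cases j <;> simp <;> omega) (by omega) H.span_eq
      (fun i => by
        rw [Fin.sum_univ_three]
        change A * r₁ i + B * r₂ i + -h * r₃ i = 0
        linear_combination -H.relation i)
      ⟨0, fun e => H.eval_relation (by
        rw [show A = 0 from e, map_zero])⟩ H.eq_smul_of_sum_eq_zero
    rw [show k + 6 + 9 + t = k + 6 + t + 9 by omega]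
    simp only [Fin.sum_univ_three, Matrix.cons_val] at key
    rw [show k + 6 + t - (k + 6) = t by omega, show k + 6 + t - 5 = k + t + 1 by omega,
      show k + 6 + t - (5 + k) = t + 1 by omega] at key
    have e1 := two_mul_choose_two (k + 6 + t)
    have e2 := two_mul_choose_two t
    have e3 := two_mul_choose_two (k + 6 + t + 9)
    have e4 := two_mul_choose_two (k + t + 1)
    have e5 := two_mul_choose_two (t + 1)
    nlinarith

lemma isHomogeneous_syzygyZero (i : Fin 3) :
    (firstSyzygyZero (X 0) (X 1) (X 2) i : S3).IsHomogeneous 5 ∧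
      (secondSyzygyZero (X 0) (X 1) (X 2) i : S3).IsHomogeneous 5 ∧
      (thirdSyzygyZero (X 0) (X 1) (X 2) i : S3).IsHomogeneous 5 := by
  fin_cases i <;>
    simp only [firstSyzygyZero, secondSyzygyZero, thirdSyzygyZero, Fin.zero_eta, Fin.mk_one,
      Fin.reduceFinMk, Matrix.cons_val] <;>
    refine ⟨?_, ?_, ?_⟩
  all_goals repeat' first
    | with_reducible apply IsHomogeneous.add
    | with_reducible apply isHomogeneous_sub
  all_goals
    with_reducible apply IsHomogeneous.of_eq
    · repeat' first
        | with_reducible exact isHomogeneous_X_pow _ _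
        | with_reducible exact isHomogeneous_X _ _
        | with_reducible exact isHomogeneous_C _ _
        | with_reducible exact isHomogeneous_ofNat _
        | with_reducible exact isHomogeneous_neg_ofNat _
        | with_reducible apply IsHomogeneous.mul
    · norm_num

lemma isHomogeneous_syzygyB (i : Fin 3) :
    (firstSyzygyB (X 0) (X 1) (X 2) i : S3).IsHomogeneous 5 ∧
      (secondSyzygyB (X 0) (X 1) (X 2) i : S3).IsHomogeneous 5 ∧
      (thirdSyzygyB (X 0) (X 1) (X 2) i : S3).IsHomogeneous 5 := by
  fin_cases i <;>
    simp only [firstSyzygyB, secondSyzygyB, thirdSyzygyB, Fin.zero_eta, Fin.mk_one,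
      Fin.reduceFinMk, Matrix.cons_val] <;>
    refine ⟨?_, ?_, ?_⟩
  all_goals repeat' first
    | with_reducible apply IsHomogeneous.add
    | with_reducible apply isHomogeneous_sub
  all_goals
    with_reducible apply IsHomogeneous.of_eq
    · repeat' first
        | with_reducible exact isHomogeneous_X_pow _ _
        | with_reducible exact isHomogeneous_X _ _
        | with_reducible exact isHomogeneous_C _ _
        | with_reducible exact isHomogeneous_ofNat _
        | with_reducible exact isHomogeneous_neg_ofNat _
        | with_reducible apply IsHomogeneous.mul
    · norm_num

lemma isHomogeneous_syzygyOne (i : Fin 3) :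
    (firstSyzygyOne (X 0) (X 1) (X 2) i : S3).IsHomogeneous 5 ∧
      (secondSyzygyOne (X 0) (X 1) (X 2) i : S3).IsHomogeneous 5 ∧
      (thirdSyzygyOne (X 0) (X 1) (X 2) i : S3).IsHomogeneous 6 := by
  fin_cases i <;>
    simp only [firstSyzygyOne, secondSyzygyOne, thirdSyzygyOne, Fin.zero_eta, Fin.mk_one,
      Fin.reduceFinMk, Matrix.cons_val] <;>
    refine ⟨?_, ?_, ?_⟩
  all_goals repeat' first
    | with_reducible apply IsHomogeneous.add
    | with_reducible apply isHomogeneous_sub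
  all_goals
    with_reducible apply IsHomogeneous.of_eq
    · repeat' first
        | with_reducible exact isHomogeneous_X_pow _ _
        | with_reducible exact isHomogeneous_X _ _
        | with_reducible exact isHomogeneous_C _ _
        | with_reducible exact isHomogeneous_ofNat _
        | with_reducible exact isHomogeneous_neg_ofNat _
        | with_reducible apply IsHomogeneous.mul
    · norm_num

lemma isHomogeneous_relationOne :
    (46980000 * X 0 ^ 2 + 7012800 * X 0 * X 2 - 210600 * X 2 ^ 2 : S3).IsHomogeneous 2 ∧
      (-9396000 * X 0 * X 2 - 644400 * X 2 ^ 2 : S3).IsHomogeneous 2 ∧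
      (-16231590000 * X 0 - 6318000 * X 1 - 2148089400 * X 2 : S3).IsHomogeneous 1 := by
  refine ⟨?_, ?_, ?_⟩
  all_goals repeat' first
    | with_reducible apply IsHomogeneous.add
    | with_reducible apply isHomogeneous_sub
  all_goals
    with_reducible apply IsHomogeneous.of_eq
    · repeat' first
        | with_reducible exact isHomogeneous_X_pow _ _
        | with_reducible exact isHomogeneous_X _ _
        | with_reducible exact isHomogeneous_C _ _
        | with_reducible exact isHomogeneous_ofNat _
        | with_reducible exact isHomogeneous_neg_ofNat _
        | with_reducible apply IsHomogeneous.mul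
    · norm_num

/-- The degree 10 curve `C'₁ : f'₁ = 0` is an MPOG-curve with exponents `(5,5,6)` and
`τ = 59`, and the curves `C'₀ : f'₀ = 0`, `C'_{b'} : f'_{b'} = 0` are nearly free with
exponents `(5,5)` and `τ = 60`. -/
theorem statement8 :
    (IsMPOGWith f1' 10 5 5 ∧ IsTjurina f1' 59) ∧
    (IsNearlyFreeWith f0' 10 5 5 ∧ IsTjurina f0' 60) ∧
    (IsNearlyFreeWith fb' 10 5 5 ∧ IsTjurina fb' 60) := by
  have h1 := certificateOne.isMinGenSyz_and_isTjurina (k := 1) (τ := 59)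
    (isHomogeneous_pencil (-1)) (fun i => (isHomogeneous_syzygyOne i).1)
    (fun i => (isHomogeneous_syzygyOne i).2.1) (fun i => (isHomogeneous_syzygyOne i).2.2)
    isHomogeneous_relationOne.1 isHomogeneous_relationOne.2.1 isHomogeneous_relationOne.2.2 rfl
  have h0 := certificateZero.isMinGenSyz_and_isTjurina (k := 0) (τ := 60)
    (isHomogeneous_pencil 0) (fun i => (isHomogeneous_syzygyZero i).1)
    (fun i => (isHomogeneous_syzygyZero i).2.1) (fun i => (isHomogeneous_syzygyZero i).2.2)
    ((isHomogeneous_neg_ofNat _).mul (isHomogeneous_X _ _))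
    ((isHomogeneous_neg_ofNat _).mul (isHomogeneous_X _ _))
    ((isHomogeneous_ofNat _).mul (isHomogeneous_X _ _)) rfl
  have hb := certificateB.isMinGenSyz_and_isTjurina (k := 0) (τ := 60)
    (isHomogeneous_pencil (64 / 81)) (fun i => (isHomogeneous_syzygyB i).1)
    (fun i => (isHomogeneous_syzygyB i).2.1) (fun i => (isHomogeneous_syzygyB i).2.2)
    ((isHomogeneous_neg_ofNat _).mul (isHomogeneous_X _ _))
    ((isHomogeneous_neg_ofNat _).mul (isHomogeneous_X _ _))
    ((isHomogeneous_ofNat _).mul (isHomogeneous_X _ _)) rfl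
  rw [show f0' + C (-1) * X 2 ^ 10 = f1' by
    rw [f1', C_neg, C_1]
    ring] at h1
  rw [C_0, zero_mul, add_zero] at h0
  exact ⟨⟨⟨rfl, _, h1.1⟩, h1.2⟩, ⟨⟨rfl, _, h0.1⟩, h0.2⟩, ⟨rfl, _, hb.1⟩, hb.2⟩

end
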